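/- arXiv:2309.09234 — 2 statements merged into one kernel-verified Lean document; each statement's English description precedes it below -/
import Mathlib

section
/- Let q belong to the Schwartz space 𝒮(ℝ;ℂ) and let λ ∈ ℂ satisfy Im(λ²) ≥ 0. Then I_λ({x₁<y₁}) · I_λ({x₁<y₁<x₂<y₂}) = 3·I_λ({x₁<y₁<x₂<y₂<x₃<y₃}) + 4·I_λ({x₁<x₂<y₁<y₂<x₃<y₃}) + 4·I_λ({x₁<x₂<y₁<x₃<y₂<y₃}) + 4·I_λ({x₁<y₁<x₂<x₃<y₂<y₃}); all integrals converge absolutely. -/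
open MeasureTheory

/-- The elementary kernel `q(y)·conj(q(x))·exp(2iλ²(y−x))`. -/
noncomputable def ker (q : ℝ → ℂ) (lam : ℂ) (x y : ℝ) : ℂ :=
  q y * (starRingEnd ℂ) (q x) * Complex.exp (2 * Complex.I * lam ^ 2 * ((y - x : ℝ) : ℂ))

/-- Integrand on `ℝ²`, in the variables `p = (x₁, y₁)`. -/
noncomputable def f2 (q : ℝ → ℂ) (lam : ℂ) (p : ℝ × ℝ) : ℂ :=
  ker q lam p.1 p.2

/-- Integrand on `ℝ⁴`, in the variables `p = (x₁, y₁, x₂, y₂)`. -/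
noncomputable def f4 (q : ℝ → ℂ) (lam : ℂ) (p : ℝ × ℝ × ℝ × ℝ) : ℂ :=
  ker q lam p.1 p.2.1 * ker q lam p.2.2.1 p.2.2.2

/-- Integrand on `ℝ⁶`, in the variables `p = (x₁, y₁, x₂, y₂, x₃, y₃)`. -/
noncomputable def f6 (q : ℝ → ℂ) (lam : ℂ) (p : ℝ × ℝ × ℝ × ℝ × ℝ × ℝ) : ℂ :=
  ker q lam p.1 p.2.1 * ker q lam p.2.2.1 p.2.2.2.1 * ker q lam p.2.2.2.2.1 p.2.2.2.2.2

/-- The region `{x₁ < y₁}` of `ℝ²`, in the variables `p = (x₁, y₁)`. -/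
def R_XY : Set (ℝ × ℝ) := {p | p.1 < p.2}

/-- The region `{x₁ < y₁ < x₂ < y₂}` of `ℝ⁴`, in the variables `p = (x₁, y₁, x₂, y₂)`. -/
def R_XYXY : Set (ℝ × ℝ × ℝ × ℝ) :=
  {p | p.1 < p.2.1 ∧ p.2.1 < p.2.2.1 ∧ p.2.2.1 < p.2.2.2}

/-- The region `{x₁ < x₂ < y₁ < y₂}` of `ℝ⁴`, in the variables `p = (x₁, y₁, x₂, y₂)`. -/
def R_XXYY : Set (ℝ × ℝ × ℝ × ℝ) :=
  {p | p.1 < p.2.2.1 ∧ p.2.2.1 < p.2.1 ∧ p.2.1 < p.2.2.2}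

/-- The region `{x₁ < y₁ < x₂ < y₂ < x₃ < y₃}` of `ℝ⁶`,
in the variables `p = (x₁, y₁, x₂, y₂, x₃, y₃)`. -/
def R_XYXYXY : Set (ℝ × ℝ × ℝ × ℝ × ℝ × ℝ) :=
  {p | p.1 < p.2.1 ∧ p.2.1 < p.2.2.1 ∧ p.2.2.1 < p.2.2.2.1 ∧
       p.2.2.2.1 < p.2.2.2.2.1 ∧ p.2.2.2.2.1 < p.2.2.2.2.2}

/-- The region `{x₁ < x₂ < y₁ < y₂ < x₃ < y₃}` of `ℝ⁶`,
in the variables `p = (x₁, y₁, x₂, y₂, x₃, y₃)`. -/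
def R_XXYYXY : Set (ℝ × ℝ × ℝ × ℝ × ℝ × ℝ) :=
  {p | p.1 < p.2.2.1 ∧ p.2.2.1 < p.2.1 ∧ p.2.1 < p.2.2.2.1 ∧
       p.2.2.2.1 < p.2.2.2.2.1 ∧ p.2.2.2.2.1 < p.2.2.2.2.2}

/-- The region `{x₁ < x₂ < y₁ < x₃ < y₂ < y₃}` of `ℝ⁶`,
in the variables `p = (x₁, y₁, x₂, y₂, x₃, y₃)`. -/
def R_XXYXYY : Set (ℝ × ℝ × ℝ × ℝ × ℝ × ℝ) :=
  {p | p.1 < p.2.2.1 ∧ p.2.2.1 < p.2.1 ∧ p.2.1 < p.2.2.2.2.1 ∧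
       p.2.2.2.2.1 < p.2.2.2.1 ∧ p.2.2.2.1 < p.2.2.2.2.2}

/-- The region `{x₁ < y₁ < x₂ < x₃ < y₂ < y₃}` of `ℝ⁶`,
in the variables `p = (x₁, y₁, x₂, y₂, x₃, y₃)`. -/
def R_XYXXYY : Set (ℝ × ℝ × ℝ × ℝ × ℝ × ℝ) :=
  {p | p.1 < p.2.1 ∧ p.2.1 < p.2.2.1 ∧ p.2.2.1 < p.2.2.2.2.1 ∧
       p.2.2.2.2.1 < p.2.2.2.1 ∧ p.2.2.2.1 < p.2.2.2.2.2}

/-- The region `{x₁ < x₂ < x₃ < y₁ < y₂ < y₃}` of `ℝ⁶`,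
in the variables `p = (x₁, y₁, x₂, y₂, x₃, y₃)`. -/
def R_XXXYYY : Set (ℝ × ℝ × ℝ × ℝ × ℝ × ℝ) :=
  {p | p.1 < p.2.2.1 ∧ p.2.2.1 < p.2.2.2.2.1 ∧ p.2.2.2.2.1 < p.2.1 ∧
       p.2.1 < p.2.2.2.1 ∧ p.2.2.2.1 < p.2.2.2.2.2}

section General

variable {α : Type*} [MeasureSpace α]

lemma setIntegral_prod_assoc_mul [SFinite (volume : Measure α)] (f : ℝ × ℝ → ℂ) (g : α → ℂ)
    (s : Set (ℝ × ℝ)) (t : Set α) :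
    ∫ p in {p : ℝ × ℝ × α | (p.1, p.2.1) ∈ s ∧ p.2.2 ∈ t}, f (p.1, p.2.1) * g p.2.2
      = (∫ p in s, f p) * ∫ p in t, g p := by
  rw [← setIntegral_prod_mul f g s t]
  exact ((volume_preserving_prodAssoc (α₁ := ℝ) (β₁ := ℝ) (γ₁ := α)).setIntegral_preimage_emb
    MeasurableEquiv.prodAssoc.measurableEmbedding _ _).symm

lemma integrableOn_prod_assoc_mul [SFinite (volume : Measure α)] {f : ℝ × ℝ → ℂ} {g : α → ℂ}
    {s : Set (ℝ × ℝ)} {t : Set α} (hf : IntegrableOn f s) (hg : IntegrableOn g t) :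
    IntegrableOn (fun p : ℝ × ℝ × α => f (p.1, p.2.1) * g p.2.2)
      {p | (p.1, p.2.1) ∈ s ∧ p.2.2 ∈ t} := by
  rw [← (volume_preserving_prodAssoc (α₁ := ℝ) (β₁ := ℝ) (γ₁ := α)).integrableOn_comp_preimage
    MeasurableEquiv.prodAssoc.measurableEmbedding]
  have h := Integrable.mul_prod hf hg
  rw [Measure.prod_restrict] at h
  exact h

end General

/-- The chain `v (f 0) < v (f 1) < ⋯` of strict inequalities between coordinates. -/
def chain {n : ℕ} (f : Fin n → Fin n) : Set (Fin n → ℝ) := {v | StrictMono (v ∘ f)}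

lemma measurableSet_chain {n : ℕ} (f : Fin n → Fin n) : MeasurableSet (chain f) := by
  have : chain f = ⋂ (i) (j) (_ : i < j), {v : Fin n → ℝ | v (f i) < v (f j)} := by
    ext v
    simp [chain, StrictMono]
  rw [this]
  exact .iInter fun i => .iInter fun j => .iInter fun _ =>
    measurableSet_lt (measurable_pi_apply _) (measurable_pi_apply _)

lemma disjoint_chain {n : ℕ} {f g : Fin n → Fin n} (hf : f.Bijective) (hg : g.Bijective)
    (hfg : f ≠ g) : Disjoint (chain f) (chain g) := by
  refine Set.disjoint_left.2 fun v hvf hvg => hfg ?_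
  let σ := Equiv.ofBijective f hf
  let τ := Equiv.ofBijective g hg
  have h : StrictMono (σ.symm ∘ τ) := by
    intro i j hij
    refine (StrictMono.lt_iff_lt (f := v ∘ f) hvf).1 ?_
    have key (i) : (v ∘ f) ((σ.symm ∘ τ) i) = (v ∘ g) i :=
      congrArg v (σ.apply_symm_apply (τ i))
    rw [key, key]
    exact hvg hij
  have hid : σ.symm ∘ τ = id := le_antisymm h.le_id h.id_le
  ext1 i
  have := congrFun hid i
  exact ((Equiv.symm_apply_eq σ).1 this).symm

/-- The integral of a product of one-variable functions over a chain depends only on the word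
formed by these functions along the chain. -/
lemma setIntegral_chain_congr {n : ℕ} {κ : Type*} (h : κ → ℝ → ℂ) (c : Fin n → κ)
    {f g : Fin n → Fin n} (hf : f.Bijective) (hg : g.Bijective) (hc : c ∘ f = c ∘ g) :
    ∫ v in chain f, ∏ i, h (c i) (v i) = ∫ v in chain g, ∏ i, h (c i) (v i) := by
  let σ := Equiv.ofBijective f hf
  let τ := Equiv.ofBijective g hg
  let π := σ.symm.trans τ
  let e := MeasurableEquiv.arrowCongr' π.symm (MeasurableEquiv.refl ℝ)
  have he : MeasurePreserving e :=
    volume_preserving_arrowCongr' π.symm (MeasurableEquiv.refl ℝ) (MeasurePreserving.id _)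
  have hev (v : Fin n → ℝ) : e v = v ∘ π := rfl
  have hpre : e ⁻¹' chain f = chain g := by
    ext v
    have : (v ∘ π) ∘ f = v ∘ g := by
      ext i
      exact congrArg (fun j => v (τ j)) (σ.symm_apply_apply i)
    simp only [Set.mem_preimage, hev, chain, Set.mem_ofPred_eq, this]
  have hcπ (i) : c (π i) = c i := by
    have := congrFun hc (σ.symm i)
    exact this.symm.trans (congrArg c (σ.apply_symm_apply i))
  rw [← he.setIntegral_preimage_emb e.measurableEmbedding, hpre]
  congr 1 with v
  rw [← Equiv.prod_comp π fun i => h (c i) (v i)]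
  simp only [hev, hcπ, Function.comp_apply]

lemma ae_injective_pi (n : ℕ) : ∀ᵐ v : Fin n → ℝ, Function.Injective v := by
  have h (i j : Fin n) (hij : i ≠ j) : ∀ᵐ v : Fin n → ℝ, v i ≠ v j := by
    let L : (Fin n → ℝ) →ₗ[ℝ] ℝ :=
      LinearMap.proj (R := ℝ) (φ := fun _ => ℝ) i - LinearMap.proj (R := ℝ) (φ := fun _ => ℝ) j
    have hL : LinearMap.ker L ≠ ⊤ := by
      intro h
      have : Pi.single i (1 : ℝ) ∈ LinearMap.ker L := h ▸ Submodule.mem_top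
      simp [L, hij] at this
    refine measure_mono_null ?_ (Measure.addHaar_submodule volume _ hL)
    intro v hv
    simpa [L, sub_eq_zero] using hv
  have h' : ∀ᵐ v : Fin n → ℝ, ∀ i j, i ≠ j → v i ≠ v j := by
    simpa only [ae_all_iff] using h
  filter_upwards [h'] with v hv i j hij
  by_contra hne
  exact hv i j hne hij

/-- The splitting of `Fin 6 → ℝ` into its coordinates, as a nested product. -/
def piFinSix : (Fin 6 → ℝ) ≃ᵐ ℝ × ℝ × ℝ × ℝ × ℝ × ℝ :=
  (MeasurableEquiv.piFinSuccAbove (fun _ : Fin 6 => ℝ) 0).trans <|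
  .prodCongr (.refl ℝ) <| (MeasurableEquiv.piFinSuccAbove (fun _ : Fin 5 => ℝ) 0).trans <|
  .prodCongr (.refl ℝ) <| (MeasurableEquiv.piFinSuccAbove (fun _ : Fin 4 => ℝ) 0).trans <|
  .prodCongr (.refl ℝ) <| (MeasurableEquiv.piFinSuccAbove (fun _ : Fin 3 => ℝ) 0).trans <|
  .prodCongr (.refl ℝ) (MeasurableEquiv.piFinTwo fun _ => ℝ)

lemma piFinSix_apply (v : Fin 6 → ℝ) : piFinSix v = (v 0, v 1, v 2, v 3, v 4, v 5) := rfl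

lemma volume_preserving_piFinSix : MeasurePreserving piFinSix := by
  have id' : MeasurePreserving (id : ℝ → ℝ) := MeasurePreserving.id _
  exact (id'.prod <| (id'.prod <| (id'.prod <| (id'.prod <|
    volume_preserving_piFinTwo fun _ : Fin 2 => ℝ).comp
    (volume_preserving_piFinSuccAbove (fun _ : Fin 3 => ℝ) 0)).comp
    (volume_preserving_piFinSuccAbove (fun _ : Fin 4 => ℝ) 0)).comp
    (volume_preserving_piFinSuccAbove (fun _ : Fin 5 => ℝ) 0)).comp
    (volume_preserving_piFinSuccAbove (fun _ : Fin 6 => ℝ) 0)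

lemma setIntegral_piFinSix {s : Set (Fin 6 → ℝ)} {t : Set (ℝ × ℝ × ℝ × ℝ × ℝ × ℝ)}
    (hst : piFinSix ⁻¹' t = s) (f : ℝ × ℝ × ℝ × ℝ × ℝ × ℝ → ℂ) :
    ∫ p in t, f p = ∫ v in s, f (piFinSix v) := by
  rw [← hst, volume_preserving_piFinSix.setIntegral_preimage_emb piFinSix.measurableEmbedding]

/-- The one-variable factors of `ker`: at `0` the one in `x`, at `1` the one in `y`. -/
noncomputable def kerFactor (q : ℝ → ℂ) (lam : ℂ) (k : Fin 2) (t : ℝ) : ℂ :=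
  ![(starRingEnd ℂ) (q t) * Complex.exp (-(2 * Complex.I * lam ^ 2 * t)),
    q t * Complex.exp (2 * Complex.I * lam ^ 2 * t)] k

lemma ker_eq_kerFactor_mul (q : ℝ → ℂ) (lam : ℂ) (x y : ℝ) :
    ker q lam x y = kerFactor q lam 0 x * kerFactor q lam 1 y := by
  have : 2 * Complex.I * lam ^ 2 * ((y - x : ℝ) : ℂ)
      = -(2 * Complex.I * lam ^ 2 * x) + 2 * Complex.I * lam ^ 2 * y := by
    push_cast; ring
  simp only [ker, kerFactor, this, Complex.exp_add, Matrix.cons_val_zero, Matrix.cons_val_one]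
  ring

lemma f6_piFinSix (q : ℝ → ℂ) (lam : ℂ) (v : Fin 6 → ℝ) :
    f6 q lam (piFinSix v) = ∏ i, kerFactor q lam (![0, 1, 0, 1, 0, 1] i) (v i) := by
  simp only [piFinSix_apply, f6, ker_eq_kerFactor_mul, Fin.prod_univ_six]
  simp
  ring

/-- Fifteen orders of six points: the shuffles of `0 < 1` with `2 < 3 < 4 < 5`. -/
def shuffleWord : Fin 15 → Fin 6 → Fin 6 :=
  ![![0, 1, 2, 3, 4, 5], ![0, 2, 1, 3, 4, 5], ![0, 2, 3, 1, 4, 5], ![0, 2, 3, 4, 1, 5],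
    ![0, 2, 3, 4, 5, 1], ![2, 0, 1, 3, 4, 5], ![2, 0, 3, 1, 4, 5], ![2, 0, 3, 4, 1, 5],
    ![2, 0, 3, 4, 5, 1], ![2, 3, 0, 1, 4, 5], ![2, 3, 0, 4, 1, 5], ![2, 3, 0, 4, 5, 1],
    ![2, 3, 4, 0, 1, 5], ![2, 3, 4, 0, 5, 1], ![2, 3, 4, 5, 0, 1]]

/-- The orders of `R_XYXYXY`, `R_XXYYXY`, `R_XXYXYY` and `R_XYXXYY`. -/
def regionWord : Fin 4 → Fin 6 → Fin 6 :=
  ![![0, 1, 2, 3, 4, 5], ![0, 2, 1, 3, 4, 5], ![0, 2, 1, 4, 3, 5], ![0, 1, 2, 4, 3, 5]]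

/-- The element of `regionWord` that spells the same word in `X` and `Y` as `shuffleWord k`. -/
def shuffleType : Fin 15 → Fin 4 := ![0, 1, 1, 2, 2, 1, 1, 2, 2, 0, 3, 3, 3, 3, 0]

lemma shuffleWord_bijective (k : Fin 15) : (shuffleWord k).Bijective := by
  rw [← Finite.injective_iff_bijective]
  revert k
  decide

lemma regionWord_bijective (k : Fin 4) : (regionWord k).Bijective := by
  rw [← Finite.injective_iff_bijective]
  revert k
  decide

lemma shuffleWord_injective : Function.Injective shuffleWord := by decide

lemma color_shuffleWord (k : Fin 15) :
    (![0, 1, 0, 1, 0, 1] : Fin 6 → Fin 2) ∘ shuffleWord k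
      = ![0, 1, 0, 1, 0, 1] ∘ regionWord (shuffleType k) := by
  revert k
  decide

lemma mem_chain_six {a b c d e f : Fin 6} {v : Fin 6 → ℝ} :
    v ∈ chain ![a, b, c, d, e, f]
      ↔ v a < v b ∧ v b < v c ∧ v c < v d ∧ v d < v e ∧ v e < v f := by
  simp [chain, Fin.strictMono_iff_lt_succ, Fin.forall_fin_succ]

/-- The region `{x₁ < y₁} × {x₂ < y₂ < x₃ < y₃}` of `ℝ⁶`. -/
def prodRegion : Set (Fin 6 → ℝ) := {v | v 0 < v 1 ∧ v 2 < v 3 ∧ v 3 < v 4 ∧ v 4 < v 5}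

lemma chain_shuffleWord_subset (k : Fin 15) : chain (shuffleWord k) ⊆ prodRegion := by
  intro v hv
  simp only [prodRegion, Set.mem_ofPred_eq]
  fin_cases k <;>
  · obtain ⟨h₁, h₂, h₃, h₄, h₅⟩ := mem_chain_six.1 hv
    refine ⟨?_, ?_, ?_, ?_⟩ <;> linarith

lemma exists_mem_chain_shuffleWord {v : Fin 6 → ℝ} (hv : v ∈ prodRegion) (hi : v.Injective) :
    ∃ k, v ∈ chain (shuffleWord k) := by
  obtain ⟨h₀, h₂, h₃, h₄⟩ := hv
  have hlt {i j : Fin 6} (hij : i ≠ j) : v i < v j ∨ v j < v i := lt_or_gt_of_ne (hi.ne hij)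
  simp only [shuffleWord, Fin.exists_fin_succ, mem_chain_six, Matrix.cons_val_zero,
    Matrix.cons_val_succ]
  have h02 := hlt (i := 0) (j := 2) (by decide)
  have h03 := hlt (i := 0) (j := 3) (by decide)
  have h04 := hlt (i := 0) (j := 4) (by decide)
  have h05 := hlt (i := 0) (j := 5) (by decide)
  have h12 := hlt (i := 1) (j := 2) (by decide)
  have h13 := hlt (i := 1) (j := 3) (by decide)
  have h14 := hlt (i := 1) (j := 4) (by decide)
  have h15 := hlt (i := 1) (j := 5) (by decide)
  clear hlt
  grind

lemma prodRegion_ae_eq : prodRegion =ᵐ[volume] ⋃ k, chain (shuffleWord k) := by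
  filter_upwards [ae_injective_pi 6] with v hv
  refine propext ⟨fun h => Set.mem_iUnion.2 (exists_mem_chain_shuffleWord h hv), fun h => ?_⟩
  obtain ⟨k, hk⟩ := Set.mem_iUnion.1 h
  exact chain_shuffleWord_subset k hk

lemma setIntegral_prodRegion {q : ℝ → ℂ} {lam : ℂ}
    (hint : IntegrableOn (fun v => f6 q lam (piFinSix v)) prodRegion) :
    ∫ v in prodRegion, f6 q lam (piFinSix v)
      = ∑ k, ∫ v in chain (regionWord (shuffleType k)), f6 q lam (piFinSix v) := by
  rw [setIntegral_congr_set prodRegion_ae_eq, integral_iUnion_fintype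
    (fun k => measurableSet_chain _)
    (fun i j hij => disjoint_chain (shuffleWord_bijective i) (shuffleWord_bijective j)
      (shuffleWord_injective.ne hij))
    (fun k => hint.mono_set (chain_shuffleWord_subset k))]
  simp only [f6_piFinSix]
  exact Finset.sum_congr rfl fun k _ => setIntegral_chain_congr _ _
    (shuffleWord_bijective k) (regionWord_bijective _) (color_shuffleWord k)

lemma integrableOn_f2 (q : SchwartzMap ℝ ℂ) {lam : ℂ} (hlam : 0 ≤ (lam ^ 2).im) :
    IntegrableOn (f2 q lam) R_XY := by
  have hq : Integrable (fun t => ‖q t‖) := q.integrable.norm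
  have hcont : Continuous (f2 q lam) := by
    have := q.continuous
    unfold f2 ker
    fun_prop
  refine Integrable.mono' (hq.mul_prod hq).integrableOn hcont.aestronglyMeasurable ?_
  refine (ae_restrict_mem (measurableSet_lt measurable_fst measurable_snd)).mono fun p hp => ?_
  have hp' : p.1 < p.2 := hp
  have hexp : ‖Complex.exp (2 * Complex.I * lam ^ 2 * ((p.2 - p.1 : ℝ) : ℂ))‖ ≤ 1 := by
    rw [Complex.norm_exp, Real.exp_le_one_iff]
    have : (2 * Complex.I * lam ^ 2 * ((p.2 - p.1 : ℝ) : ℂ)).re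
        = -(2 * (lam ^ 2).im * (p.2 - p.1)) := by
      rw [Complex.re_mul_ofReal]
      simp [mul_assoc]
    rw [this]
    have := mul_nonneg hlam (sub_nonneg.2 hp'.le)
    linarith
  simp only [f2, ker, norm_mul, RCLike.norm_conj]
  calc ‖q p.2‖ * ‖q p.1‖ * _ ≤ ‖q p.2‖ * ‖q p.1‖ * 1 := by gcongr
    _ = ‖q p.1‖ * ‖q p.2‖ := by ring

lemma integrableOn_f4 (q : SchwartzMap ℝ ℂ) {lam : ℂ} (hlam : 0 ≤ (lam ^ 2).im) :
    IntegrableOn (f4 q lam) {p | p.1 < p.2.1 ∧ p.2.2.1 < p.2.2.2} :=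
  integrableOn_prod_assoc_mul (integrableOn_f2 q hlam) (integrableOn_f2 q hlam)

lemma f6_eq_f2_mul_f4 (q : ℝ → ℂ) (lam : ℂ) :
    f6 q lam = fun p => f2 q lam (p.1, p.2.1) * f4 q lam p.2.2 := by
  ext p
  simp only [f6, f2, f4, mul_assoc]

lemma integrableOn_f6 (q : SchwartzMap ℝ ℂ) {lam : ℂ} (hlam : 0 ≤ (lam ^ 2).im) :
    IntegrableOn (f6 q lam)
      {p | p.1 < p.2.1 ∧ p.2.2.1 < p.2.2.2.1 ∧ p.2.2.2.2.1 < p.2.2.2.2.2} := by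
  rw [f6_eq_f2_mul_f4]
  exact integrableOn_prod_assoc_mul (integrableOn_f2 q hlam) (integrableOn_f4 q hlam)

/-- Shuffle identity `XY × (XY)⁽²⁾ = 3·XYXYXY + 4·XXYYXY + 4·XXYXYY + 4·XYXXYY` for the
iterated integrals `I_λ(Σ) = ∫_Σ ∏ q(y_k) conj(q(x_k)) e^{2iλ²(y_k−x_k)}`, for Schwartz `q`
and `Im(λ²) ≥ 0`; all integrals converge absolutely. -/
theorem shuffle_XY_mul_XYXY (q : SchwartzMap ℝ ℂ) (lam : ℂ) (hlam : 0 ≤ (lam ^ 2).im) :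
    IntegrableOn (f2 ⇑q lam) R_XY volume ∧
    IntegrableOn (f4 ⇑q lam) R_XYXY volume ∧
    IntegrableOn (f6 ⇑q lam) R_XYXYXY volume ∧
    IntegrableOn (f6 ⇑q lam) R_XXYYXY volume ∧
    IntegrableOn (f6 ⇑q lam) R_XXYXYY volume ∧
    IntegrableOn (f6 ⇑q lam) R_XYXXYY volume ∧
    (∫ p in R_XY, f2 ⇑q lam p) * (∫ p in R_XYXY, f4 ⇑q lam p)
      = 3 * (∫ p in R_XYXYXY, f6 ⇑q lam p)
        + 4 * (∫ p in R_XXYYXY, f6 ⇑q lam p)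
        + 4 * (∫ p in R_XXYXYY, f6 ⇑q lam p)
        + 4 * (∫ p in R_XYXXYY, f6 ⇑q lam p) := by
  have h4 := integrableOn_f4 q hlam
  have h6 := integrableOn_f6 q hlam
  refine ⟨integrableOn_f2 q hlam, h4.mono_set ?_, h6.mono_set ?_, h6.mono_set ?_,
    h6.mono_set ?_, h6.mono_set ?_, ?_⟩
  · rintro p ⟨h₁, h₂, h₃⟩
    exact ⟨h₁, h₃⟩
  iterate 4
    rintro p ⟨h₁, h₂, h₃, h₄, h₅⟩
    refine ⟨?_, ?_, ?_⟩ <;> linarith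
  have hint : IntegrableOn (fun v => f6 q lam (piFinSix v)) prodRegion := by
    refine ((volume_preserving_piFinSix.integrableOn_comp_preimage
      piFinSix.measurableEmbedding).2 h6).mono_set ?_
    rintro v ⟨h₁, h₂, h₃, h₄⟩
    exact ⟨h₁, h₂, h₄⟩
  rw [← setIntegral_prod_assoc_mul, ← f6_eq_f2_mul_f4,
    setIntegral_piFinSix (s := prodRegion) rfl, setIntegral_prodRegion hint]
  have hXYXYXY : piFinSix ⁻¹' R_XYXYXY = chain (regionWord 0) := Set.ext fun _ => mem_chain_six.symm
  have hXXYYXY : piFinSix ⁻¹' R_XXYYXY = chain (regionWord 1) := Set.ext fun _ => mem_chain_six.symm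
  have hXXYXYY : piFinSix ⁻¹' R_XXYXYY = chain (regionWord 2) := Set.ext fun _ => mem_chain_six.symm
  have hXYXXYY : piFinSix ⁻¹' R_XYXXYY = chain (regionWord 3) := Set.ext fun _ => mem_chain_six.symm
  rw [setIntegral_piFinSix hXYXYXY, setIntegral_piFinSix hXXYYXY, setIntegral_piFinSix hXXYXYY,
    setIntegral_piFinSix hXYXXYY]
  simp only [Fin.sum_univ_succ, shuffleType, Matrix.cons_val_zero, Matrix.cons_val_succ,
    Finset.univ_eq_empty, Finset.sum_empty]
  ring
end

section
/- Let q belong to the Schwartz space 𝒮(ℝ;ℂ), let λ ∈ ℂ satisfy Im(λ²) > 0, and let N ≥ 1 be a natural number. Define M_k := (−1)^k ∫_ℝ ξ^{k+1}·|q̂(ξ)|² dξ for 0 ≤ k ≤ N−1. Then | Re( c₂(λ/√2) − (i/2)·Σ_{k=0}^{N−1} M_k·λ^{−2k−2} ) | ≤ (|λ|^{−2N}/2) · ∫_ℝ |ξ|^{N+1} · ( Im(λ²) + |Re(λ²) + ξ| ) / ( (Re(λ²) + ξ)² + (Im(λ²))² ) · |q̂(ξ)|² dξ. -/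
open MeasureTheory

/-- The unitary Fourier transform `q̂(ξ) = (2π)^{−1/2} ∫ q(x) e^{−ixξ} dx`. -/
noncomputable def ft (q : ℝ → ℂ) (ξ : ℝ) : ℂ :=
  ((Real.sqrt (2 * Real.pi) : ℝ) : ℂ)⁻¹ * ∫ x : ℝ, q x * Complex.exp (-Complex.I * x * ξ)

/-- The quantity `c₂(λ) = i ∫ ξ/(4λ²+2ξ) |q̂(ξ)|² dξ = s₂(λ) + (i/2)‖q‖²_{L²}`. -/
noncomputable def c2 (q : ℝ → ℂ) (lam : ℂ) : ℂ :=
  Complex.I * ∫ ξ : ℝ, (ξ : ℂ) / (4 * lam ^ 2 + 2 * (ξ : ℂ)) * ((‖ft q ξ‖ : ℝ) : ℂ) ^ 2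

/-- `ft` is a rescaling of Mathlib's Fourier transform. -/
lemma ft_eq_fourier (q : SchwartzMap ℝ ℂ) (ξ : ℝ) :
    ft q ξ = ((Real.sqrt (2 * Real.pi) : ℝ) : ℂ)⁻¹ *
      (FourierTransform.fourier q : SchwartzMap ℝ ℂ) (ξ / (2 * Real.pi)) := by
  rw [ft, SchwartzMap.fourier_coe, Real.fourier_real_eq_integral_exp_smul]
  congr 2 with x
  rw [smul_eq_mul, mul_comm]
  congr 2
  have : (Real.pi : ℂ) ≠ 0 := by exact_mod_cast Real.pi_ne_zero
  push_cast
  field_simp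

lemma SchwartzMap.integrable_pow_mul_norm_sq (f : SchwartzMap ℝ ℂ) (k : ℕ) :
    Integrable fun ξ : ℝ ↦ ξ ^ k * ‖f ξ‖ ^ 2 := by
  have h : Integrable fun ξ : ℝ ↦ (‖ξ‖ ^ k * ‖f ξ‖) * ‖f ξ‖ :=
    (f.integrable_pow_mul volume k).mul_bdd (c := SchwartzMap.seminorm ℝ 0 0 f)
      f.continuous.norm.aestronglyMeasurable
      (.of_forall fun ξ ↦ by simpa using SchwartzMap.norm_le_seminorm ℝ f ξ)
  refine h.mono' ?_ (.of_forall fun ξ ↦ ?_)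
  · have := f.continuous
    exact Continuous.aestronglyMeasurable (by fun_prop)
  · rw [norm_mul, norm_pow, norm_pow, norm_norm, mul_assoc, sq]

lemma integrable_pow_mul_norm_ft_sq (q : SchwartzMap ℝ ℂ) (k : ℕ) :
    Integrable fun ξ : ℝ ↦ ξ ^ k * ‖ft q ξ‖ ^ 2 := by
  have h := ((SchwartzMap.integrable_pow_mul_norm_sq (FourierTransform.fourier q) k).comp_div
    (R := 2 * Real.pi) (by positivity)).const_mul
      ((2 * Real.pi) ^ k * ‖((Real.sqrt (2 * Real.pi) : ℝ) : ℂ)⁻¹‖ ^ 2)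
  refine h.congr (.of_forall fun ξ ↦ ?_)
  have : Real.pi ≠ 0 := Real.pi_ne_zero
  simp only [ft_eq_fourier, norm_mul, mul_pow, div_pow]
  field_simp

lemma norm_inv_add_ofReal_le {z : ℂ} (hz : 0 < z.im) (ξ : ℝ) : ‖(z + ξ)⁻¹‖ ≤ z.im⁻¹ := by
  rw [norm_inv]
  refine inv_anti₀ hz ?_
  simpa using (le_abs_self _).trans (Complex.abs_im_le_norm (z + ξ))

lemma norm_inv_add_ofReal_le_div {z : ℂ} (hz : 0 < z.im) (ξ : ℝ) :
    ‖(z + ξ)⁻¹‖ ≤ (z.im + |z.re + ξ|) / ((z.re + ξ) ^ 2 + z.im ^ 2) := by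
  have h := Complex.norm_le_abs_re_add_abs_im (z + ξ)
  have hsq := Complex.sq_norm (z + ξ)
  simp only [Complex.normSq_apply, Complex.add_re, Complex.add_im, Complex.ofReal_re,
    Complex.ofReal_im, add_zero, abs_of_pos hz] at h hsq
  have hpos : 0 < ‖z + ξ‖ := by
    rw [norm_pos_iff]
    intro h0
    simpa [hz.ne'] using congrArg Complex.im h0
  rw [norm_inv, show (z.re + ξ) ^ 2 + z.im ^ 2 = ‖z + ξ‖ ^ 2 by rw [hsq]; ring,
    inv_eq_one_div, div_le_div_iff₀ hpos (by positivity)]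
  nlinarith

/-- Finite geometric expansion of `ξ / (z + ξ)` in powers of `z⁻¹`, with remainder. -/
lemma div_add_sub_sum_eq {z x : ℂ} (hz : z ≠ 0) (hzx : z + x ≠ 0) (N : ℕ) :
    x / (z + x) - ∑ k ∈ Finset.range N, (-1) ^ k * x ^ (k + 1) * z⁻¹ ^ (k + 1)
      = (-1) ^ N * z⁻¹ ^ N * (x ^ (N + 1) * (z + x)⁻¹) := by
  induction N with
  | zero => simp [div_eq_mul_inv]
  | succ n ih =>
    rw [Finset.sum_range_succ, ← sub_sub, ih]
    linear_combination (-1) ^ n * z⁻¹ ^ n * x ^ (n + 1) *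
      (z⁻¹ * mul_inv_cancel₀ hzx - (z + x)⁻¹ * mul_inv_cancel₀ hz)

lemma integrable_pow_mul_inv_mul {W : ℝ → ℝ} {z : ℂ} (hz : 0 < z.im) {k : ℕ}
    (hW : Integrable fun ξ : ℝ ↦ ξ ^ k * W ξ) :
    Integrable fun ξ : ℝ ↦ (ξ : ℂ) ^ k * (z + ξ)⁻¹ * (W ξ : ℂ) := by
  have h := hW.ofReal (𝕜 := ℂ) |>.mul_bdd (g := fun ξ : ℝ ↦ (z + ξ)⁻¹) (c := z.im⁻¹)
    (Measurable.aestronglyMeasurable (by fun_prop)) (.of_forall (norm_inv_add_ofReal_le hz))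
  refine h.congr (.of_forall fun ξ ↦ ?_)
  simp only [RCLike.ofReal_mul, RCLike.ofReal_pow, Complex.coe_algebraMap]
  ring

/-- The integrated geometric expansion: a Cauchy-type transform minus its truncated moment series
at infinity. -/
lemma integral_div_sub_moment_sum {W : ℝ → ℝ}
    (hW : ∀ k : ℕ, Integrable fun ξ : ℝ ↦ ξ ^ k * W ξ) {z : ℂ} (hz : 0 < z.im) (N : ℕ) :
    (∫ ξ : ℝ, (ξ : ℂ) / (z + ξ) * (W ξ : ℂ))
        - ∑ k ∈ Finset.range N,
            (((-1 : ℝ) ^ k * ∫ ξ : ℝ, ξ ^ (k + 1) * W ξ : ℝ) : ℂ) * z⁻¹ ^ (k + 1)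
      = (-1) ^ N * z⁻¹ ^ N * ∫ ξ : ℝ, (ξ : ℂ) ^ (N + 1) * (z + ξ)⁻¹ * (W ξ : ℂ) := by
  have hz0 : z ≠ 0 := by rintro rfl; simp at hz
  have hzξ (ξ : ℝ) : z + ξ ≠ 0 := fun h0 ↦ by
    simpa [hz.ne'] using congrArg Complex.im h0
  have hterm (k : ℕ) : Integrable fun ξ : ℝ ↦
      (-1 : ℂ) ^ k * z⁻¹ ^ (k + 1) * ((ξ ^ (k + 1) * W ξ : ℝ) : ℂ) :=
    (hW (k + 1)).ofReal.const_mul _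
  have hsum : ∑ k ∈ Finset.range N,
        (((-1 : ℝ) ^ k * ∫ ξ : ℝ, ξ ^ (k + 1) * W ξ : ℝ) : ℂ) * z⁻¹ ^ (k + 1)
      = ∫ ξ : ℝ, ∑ k ∈ Finset.range N,
          (-1 : ℂ) ^ k * z⁻¹ ^ (k + 1) * ((ξ ^ (k + 1) * W ξ : ℝ) : ℂ) := by
    rw [integral_finsetSum _ fun k _ ↦ hterm k]
    refine Finset.sum_congr rfl fun k _ ↦ ?_
    rw [integral_const_mul, integral_complex_ofReal]
    push_cast
    ring
  have hmain : Integrable fun ξ : ℝ ↦ (ξ : ℂ) / (z + ξ) * (W ξ : ℂ) := by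
    simpa [div_eq_mul_inv] using integrable_pow_mul_inv_mul hz (hW 1)
  rw [hsum, ← integral_sub hmain (integrable_finsetSum _ fun k _ ↦ hterm k),
    ← integral_const_mul]
  congr 1 with ξ
  have h := congrArg (· * (W ξ : ℂ)) (div_add_sub_sum_eq hz0 (hzξ ξ) N)
  simp only [sub_mul, Finset.sum_mul] at h
  rw [← mul_assoc, ← h]
  congr 1
  refine Finset.sum_congr rfl fun k _ ↦ ?_
  push_cast
  ring

lemma norm_integral_pow_mul_inv_mul_le {W : ℝ → ℝ} (hW0 : ∀ ξ, 0 ≤ W ξ) {z : ℂ} (hz : 0 < z.im)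
    {k : ℕ} (hW : Integrable fun ξ : ℝ ↦ ξ ^ k * W ξ) :
    ‖∫ ξ : ℝ, (ξ : ℂ) ^ k * (z + ξ)⁻¹ * (W ξ : ℂ)‖
      ≤ ∫ ξ : ℝ, |ξ| ^ k * (z.im + |z.re + ξ|) / ((z.re + ξ) ^ 2 + z.im ^ 2) * W ξ := by
  refine norm_integral_le_of_norm_le ?_ (.of_forall fun ξ ↦ ?_)
  · have hbdd (ξ : ℝ) :
        ‖(z.im + |z.re + ξ|) / ((z.re + ξ) ^ 2 + z.im ^ 2)‖ ≤ 2 * z.im⁻¹ := by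
      rw [Real.norm_of_nonneg (by positivity), ← div_eq_mul_inv,
        div_le_div_iff₀ (by positivity) hz, ← sq_abs (z.re + ξ)]
      nlinarith [sq_nonneg (|z.re + ξ| - z.im), sq_nonneg (|z.re + ξ|)]
    have h := hW.norm.mul_bdd (Measurable.aestronglyMeasurable (by fun_prop)) (.of_forall hbdd)
    refine h.congr (.of_forall fun ξ ↦ ?_)
    simp only [norm_mul, norm_pow, Real.norm_eq_abs, abs_of_nonneg (hW0 ξ)]
    ring
  · rw [norm_mul, norm_mul, norm_pow, Complex.norm_real, Complex.norm_real, Real.norm_eq_abs,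
      Real.norm_of_nonneg (hW0 ξ), mul_div_assoc]
    have := hW0 ξ
    gcongr
    exact norm_inv_add_ofReal_le_div hz ξ

lemma c2_div_sqrt_two (q : ℝ → ℂ) (lam : ℂ) :
    c2 q (lam / ((Real.sqrt 2 : ℝ) : ℂ))
      = Complex.I / 2 * ∫ ξ : ℝ, (ξ : ℂ) / (lam ^ 2 + ξ) * ((‖ft q ξ‖ ^ 2 : ℝ) : ℂ) := by
  have h2 : ((Real.sqrt 2 : ℝ) : ℂ) ^ 2 = 2 := by
    exact_mod_cast Real.sq_sqrt (zero_le_two (α := ℝ))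
  rw [c2, div_mul_eq_mul_div, mul_div_assoc, ← integral_div]
  congr 2 with ξ
  rw [div_pow, h2, show 4 * (lam ^ 2 / 2) + 2 * (ξ : ℂ) = 2 * (lam ^ 2 + ξ) by ring,
    mul_comm (2 : ℂ), ← div_div]
  push_cast
  ring

/-- For Schwartz `q`, `Im(λ²) > 0` and `N ≥ 1`: with
`M_k = (−1)^k ∫ ξ^{k+1} |q̂(ξ)|² dξ`, one has
`|Re(c₂(λ/√2) − (i/2) Σ_{k<N} M_k λ^{−2k−2})|
  ≤ (|λ|^{−2N}/2) ∫ |ξ|^{N+1} (Im λ² + |Re λ² + ξ|)/((Re λ² + ξ)² + (Im λ²)²) |q̂(ξ)|² dξ`. -/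
theorem re_c2_expansion_error (q : SchwartzMap ℝ ℂ) (lam : ℂ) (hlam : 0 < (lam ^ 2).im)
    (N : ℕ) (hN : 1 ≤ N) :
    |((c2 ⇑q (lam / ((Real.sqrt 2 : ℝ) : ℂ))
        - Complex.I / 2 *
            ∑ k ∈ Finset.range N,
              (((-1 : ℝ) ^ k * ∫ ξ : ℝ, ξ ^ (k + 1) * ‖ft ⇑q ξ‖ ^ 2 : ℝ) : ℂ)
                * lam ^ (-2 * (k : ℤ) - 2)).re)|
      ≤ ‖lam‖ ^ (-2 * (N : ℤ)) / 2 *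
          ∫ ξ : ℝ,
            |ξ| ^ (N + 1) * ((lam ^ 2).im + |(lam ^ 2).re + ξ|)
                / (((lam ^ 2).re + ξ) ^ 2 + ((lam ^ 2).im) ^ 2)
              * ‖ft ⇑q ξ‖ ^ 2 := by
  set W : ℝ → ℝ := fun ξ ↦ ‖ft ⇑q ξ‖ ^ 2
  have hW (k : ℕ) : Integrable fun ξ : ℝ ↦ ξ ^ k * W ξ := integrable_pow_mul_norm_ft_sq q k
  have hpow (k : ℕ) : lam ^ (-2 * (k : ℤ) - 2) = (lam ^ 2)⁻¹ ^ (k + 1) := by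
    rw [← inv_pow, ← pow_mul, inv_pow, ← zpow_natCast, ← zpow_neg]
    congr 1
    push_cast
    ring
  have hnorm : ‖(-1 : ℂ) ^ N * (lam ^ 2)⁻¹ ^ N‖ = ‖lam‖ ^ (-2 * (N : ℤ)) := by
    rw [norm_mul, norm_pow, norm_neg, norm_one, one_pow, one_mul, norm_pow, norm_inv, norm_pow,
      ← inv_pow, ← pow_mul, inv_pow, ← zpow_natCast, ← zpow_neg]
    push_cast
    ring_nf
  refine (Complex.abs_re_le_norm _).trans ?_
  simp_rw [hpow]
  rw [c2_div_sqrt_two, ← mul_sub, integral_div_sub_moment_sum hW hlam N, norm_mul, norm_mul, hnorm,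
    norm_div, Complex.norm_I, Complex.norm_two, ← mul_assoc, one_div_mul_eq_div]
  gcongr
  exact norm_integral_pow_mul_inv_mul_le (fun ξ ↦ sq_nonneg _) hlam (hW (N + 1))
end
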